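/- The set Pi_{p} := {1 <= t <= r : (p(t+h)_{t+h})^+_+ >= p(t+h+1) >= 1 for all h >= 0} is non-empty, and every admissible numerical function with Hilbert polynomial p(z) has regularity at least rho_{p}. Moreover: (i) rhobar_{p} >= max{rho_{p}, rho_{Delta p} - 1}; (ii) if rho_{p} > 0, then for every integer c > 0 one has rho_{p+c} <= rho_{p} and rhobar_{p+c} <= rhobar_{p}. -/

import Mathlib

open scoped Classical

noncomputable section

/-! ## Binomial expansions and the Macaulay operations `(a_t)^+_+` and `(a_t)^-_-` -/

/-- The largest `k` such that `C(k,t) ≤ a` (top coefficient of the greedy binomial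
expansion of `a` in base `t`). -/
def expTop (a t : ℕ) : ℕ := Nat.findGreatest (fun k => Nat.choose k t ≤ a) (a + t + 1)

/-- `(a_t)^+_+` : if `a = C(k(t),t) + ... + C(k(j),j)` is the binomial expansion of `a`
in base `t`, then `plusPlus a t = C(k(t)+1,t+1) + ... + C(k(j)+1,j+1)`; it sends `0` to `0`. -/
def plusPlus : ℕ → ℕ → ℕ
  | _, 0 => 0
  | a, t + 1 =>
    if a = 0 then 0
    else Nat.choose (expTop a (t + 1) + 1) (t + 2) +
      plusPlus (a - Nat.choose (expTop a (t + 1)) (t + 1)) t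

/-- `(a_t)^-_-` : if `a = C(k(t),t) + ... + C(k(j),j)` is the binomial expansion of `a`
in base `t`, then `minusMinus a t = C(k(t)-1,t-1) + ... + C(k(j)-1,j-1)`; it sends `0` to `0`. -/
def minusMinus : ℕ → ℕ → ℕ
  | _, 0 => 0
  | a, t + 1 =>
    if a = 0 then 0
    else Nat.choose (expTop a (t + 1) - 1) t +
      minusMinus (a - Nat.choose (expTop a (t + 1)) (t + 1)) t

/-! ## Numerical functions -/

/-- A numerical function (modelled with values in `ℤ`) is *admissible* (an O-sequence) if it is
nonnegative, `H 0 = 1` and `H (t+1) ≤ (H(t)_t)^+_+` for every `t ≥ 1`. -/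
def OSeq (H : ℕ → ℤ) : Prop :=
  (∀ t, 0 ≤ H t) ∧ H 0 = 1 ∧ ∀ t, 1 ≤ t → H (t + 1) ≤ (plusPlus (H t).toNat t : ℤ)

/-- First derivative of a numerical function: `Δf(0) = 1`, `Δf(t) = f(t) - f(t-1)`. -/
def nderiv (f : ℕ → ℤ) : ℕ → ℤ
  | 0 => 1
  | t + 1 => f (t + 1) - f t

/-- Integral of a numerical function: `Σg(0) = 1`, `Σg(t) = Σg(t-1) + g(t)`. -/
def ninteg (g : ℕ → ℤ) : ℕ → ℤ
  | 0 => 1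
  | t + 1 => ninteg g t + g (t + 1)

/-! ## Admissible Hilbert polynomials in Gotzmann form -/

/-- The integer-valued binomial coefficient `C(a,k)` for `a : ℤ`, agreeing with the
polynomial binomial coefficient `a(a-1)⋯(a-k+1)/k!`. -/
def zchoose (a : ℤ) (k : ℕ) : ℤ :=
  if 0 ≤ a then (a.toNat.choose k : ℤ)
  else (-1) ^ k * (((k : ℤ) - 1 - a).toNat.choose k : ℤ)

/-- An admissible Hilbert polynomial, recorded through its Gotzmann form
`p(z) = C(z+k₁,k₁) + C(z+k₂-1,k₂) + ... + C(z+k_r-(r-1),k_r)` with `k₁ ≥ k₂ ≥ ... ≥ k_r ≥ 0`. -/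
structure GotzmannPoly where
  ks : List ℕ
  sorted : ks.Pairwise (· ≥ ·)

namespace GotzmannPoly

/-- The Gotzmann number `r` of `p`. -/
def r (p : GotzmannPoly) : ℕ := p.ks.length

/-- The degree of `p`, namely `k₁`. -/
def degree (p : GotzmannPoly) : ℕ := p.ks.headD 0

/-- Evaluation of `p` at an integer. -/
def eval (p : GotzmannPoly) (z : ℤ) : ℤ :=
  ∑ i ∈ Finset.range p.r, zchoose (z + (p.ks.getD i 0 : ℤ) - i) (p.ks.getD i 0)

/-- The first difference `Δp(z) = p(z) - p(z-1)`, in Gotzmann form. -/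
def delta (p : GotzmannPoly) : GotzmannPoly where
  ks := (p.ks.filter fun k => 1 ≤ k).map fun k => k - 1
  sorted := by
    refine List.Pairwise.map _ (fun {a b} h => Nat.sub_le_sub_right h 1) ?_
    exact p.sorted.filter _

/-- Iterated first difference `Δ^i p`. -/
def deltaIter (p : GotzmannPoly) (i : ℕ) : GotzmannPoly := delta^[i] p

/-- The polynomial `p(z) + c`, in Gotzmann form. -/
def addConst (p : GotzmannPoly) (c : ℕ) : GotzmannPoly where
  ks := p.ks ++ List.replicate c 0
  sorted := by
    rw [List.pairwise_append]
    refine ⟨p.sorted, ?_, ?_⟩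
    · exact List.pairwise_replicate.2 (Or.inr le_rfl)
    · intro a _ b hb
      rw [List.eq_of_mem_replicate hb]
      exact Nat.zero_le a

end GotzmannPoly

/-- The set `Π_p = {1 ≤ t ≤ r : (p(t+h)_{t+h})^+_+ ≥ p(t+h+1) ≥ 1 for all h ≥ 0}`. -/
def PiSet (p : GotzmannPoly) : Set ℕ :=
  {t | 1 ≤ t ∧ t ≤ p.r ∧ ∀ h : ℕ,
      p.eval ((t : ℤ) + (h : ℤ) + 1) ≤ (plusPlus (p.eval ((t : ℤ) + (h : ℤ))).toNat (t + h) : ℤ) ∧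
      1 ≤ p.eval ((t : ℤ) + (h : ℤ) + 1)}

/-- `ρ_p`: `0` if `min Π_p = 1` and `p(0) = 1`, and `min Π_p` otherwise. -/
def rhoP (p : GotzmannPoly) : ℕ :=
  if sInf (PiSet p) = 1 ∧ p.eval 0 = 1 then 0 else sInf (PiSet p)

/-- The minimal function `f^ρ_p` : `f(t) = p(t)` for `t ≥ ρ` and
`f(t) = ((f(t+1))_{t+1})^-_-` for `t < ρ`. -/
def fmin (p : GotzmannPoly) (ρ : ℕ) (t : ℕ) : ℤ :=
  if h : ρ ≤ t then p.eval (t : ℤ)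
  else (minusMinus (fmin p ρ (t + 1)).toNat (t + 1) : ℤ)
termination_by ρ - t
decreasing_by omega

/-- The function `g^ρ_p` : `g(t) = p(t)` for `t ≥ ρ`, `g(ρ-1) = p(ρ-1) + 1` and
`g(t) = ((g(t+1))_{t+1})^-_-` for `t < ρ-1`. -/
def gmin (p : GotzmannPoly) (ρ : ℕ) (t : ℕ) : ℤ :=
  if h : ρ ≤ t then p.eval (t : ℤ)
  else if t = ρ - 1 then p.eval (t : ℤ) + 1
  else (minusMinus (gmin p ρ (t + 1)).toNat (t + 1) : ℤ)
termination_by ρ - t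
decreasing_by omega

/-- `H` has regularity `ρ` (with respect to the Hilbert polynomial `p`): `ρ` is the least
integer such that `H(t) = p(t)` for all `t ≥ ρ`. -/
def IsRegOf (p : GotzmannPoly) (H : ℕ → ℤ) (ρ : ℕ) : Prop :=
  (∀ t : ℕ, ρ ≤ t → H t = p.eval (t : ℤ)) ∧
  ∀ ρ' : ℕ, (∀ t : ℕ, ρ' ≤ t → H t = p.eval (t : ℤ)) → ρ ≤ ρ'

/-- `H` has Hilbert polynomial `p`, i.e. eventually agrees with `p`. -/
def HasHP (p : GotzmannPoly) (H : ℕ → ℤ) : Prop :=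
  ∃ N : ℕ, ∀ t : ℕ, N ≤ t → H t = p.eval (t : ℤ)

/-- `F(p,ρ)`: the set of Hilbert functions of closed projective subschemes (i.e. numerical
functions which are admissible together with their first derivative) with Hilbert
polynomial `p` and regularity `ρ`. -/
def Fset (p : GotzmannPoly) (ρ : ℕ) : Set (ℕ → ℤ) :=
  {H | OSeq H ∧ OSeq (nderiv H) ∧ IsRegOf p H ρ}

/-- `ρ̄_p`: the minimal `ρ` such that `F(p,ρ)` is non-empty. -/
def rhobar (p : GotzmannPoly) : ℕ := sInf {ρ | (Fset p ρ).Nonempty}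

/-! ## Monomial ideals in `K[x₀,…,xₙ]` (combinatorial model) -/

/-- Monomials of `K[x₀,…,xₙ]`, as exponent vectors. -/
abbrev Mon (n : ℕ) := Fin (n + 1) → ℕ

/-- Degree of a monomial. -/
def mdeg {n : ℕ} (m : Mon n) : ℕ := ∑ i, m i

/-- `T_t`, the set of terms of degree `t`. -/
def Tset (n t : ℕ) : Set (Mon n) := {m | mdeg m = t}

/-- A set of monomials closed under multiplication by arbitrary monomials (a monomial ideal). -/
def MonIdeal {n : ℕ} (J : Set (Mon n)) : Prop :=
  ∀ m ∈ J, ∀ m' : Mon n, m + m' ∈ J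

/-- The elementary Borel move sending `x^m` to `x_i · x^m / x_j`. -/
def borelStep {n : ℕ} (m : Mon n) (j i : Fin (n + 1)) : Mon n :=
  fun l => if l = j then m l - 1 else if l = i then m l + 1 else m l

/-- One elementary Borel move `x_j ↦ x_i` with `j < i`. -/
def borelMove {n : ℕ} (a b : Mon n) : Prop :=
  ∃ j i : Fin (n + 1), j < i ∧ 1 ≤ a j ∧ b = borelStep a j i

/-- The Borel (partial) order `≤_B` on monomials. -/
def borelLE {n : ℕ} : Mon n → Mon n → Prop := Relation.ReflTransGen borelMove

/-- A strongly stable (Borel) monomial ideal. -/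
def StronglyStable {n : ℕ} (J : Set (Mon n)) : Prop :=
  MonIdeal J ∧ ∀ m ∈ J, ∀ j i : Fin (n + 1), j < i → 1 ≤ m j → borelStep m j i ∈ J

/-- A Borel set in `T_t`: a set of degree-`t` monomials closed upwards under `≤_B`. -/
def IsBorelSet {n : ℕ} (t : ℕ) (B : Set (Mon n)) : Prop :=
  B ⊆ Tset n t ∧ ∀ a ∈ B, ∀ b : Mon n, borelLE a b → b ∈ B

/-- Saturation of a monomial ideal:
`J^sat = {m : for every i there is k with x_i^k · m ∈ J}`. -/
def monSat {n : ℕ} (J : Set (Mon n)) : Set (Mon n) :=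
  {m | ∀ i : Fin (n + 1), ∃ k : ℕ, (fun l => if l = i then m l + k else m l) ∈ J}

/-- The monomial ideal generated by a set of monomials. -/
def genIdeal {n : ℕ} (B : Set (Mon n)) : Set (Mon n) :=
  {m | ∃ b ∈ B, ∃ c : Mon n, m = b + c}

/-- The Hilbert function of `S/J` for a monomial ideal `J`: the number of degree-`t`
monomials outside `J`. -/
def hilb {n : ℕ} (J : Set (Mon n)) (t : ℕ) : ℕ :=
  Set.ncard {m : Mon n | mdeg m = t ∧ m ∉ J}

/-- `m / x_i` as an exponent vector. -/
def shrinkAt {n : ℕ} (m : Mon n) (i : Fin (n + 1)) : Mon n :=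
  fun l => if l = i then m l - 1 else m l

/-- `m` is a minimal (monomial) generator of the monomial ideal `J`. -/
def IsMinGen {n : ℕ} (J : Set (Mon n)) (m : Mon n) : Prop :=
  m ∈ J ∧ ∀ i : Fin (n + 1), 1 ≤ m i → shrinkAt m i ∉ J

/-- The Castelnuovo–Mumford regularity of a strongly stable ideal: the maximal degree of a
minimal monomial generator. -/
def monReg {n : ℕ} (J : Set (Mon n)) : ℕ :=
  sSup {d | ∃ m : Mon n, IsMinGen J m ∧ mdeg m = d}

/-- `m_u`: the minimal Castelnuovo–Mumford regularity of a closed projective subscheme with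
Hilbert function `u`, i.e. the minimum of `reg J` over all `n` and all saturated strongly
stable ideals `J ⊆ K[x₀,…,xₙ]` with `H_{S/J} = u`. -/
def mReg (u : ℕ → ℤ) : ℕ :=
  sInf {r | ∃ (n : ℕ) (J : Set (Mon n)), StronglyStable J ∧ monSat J = J ∧
      (∀ t : ℕ, (hilb J t : ℤ) = u t) ∧ monReg J = r}

/-- `M(p,ρ) = {m_u : u ∈ F(p,ρ)}`. -/
def Mset (p : GotzmannPoly) (ρ : ℕ) : Set ℕ := {r | ∃ u ∈ Fset p ρ, mReg u = r}

/-- `m^ρ_p = min M(p,ρ)`. -/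
def mRho (p : GotzmannPoly) (ρ : ℕ) : ℕ := sInf (Mset p ρ)

/-- `m_p`: the minimal Castelnuovo–Mumford regularity of schemes with Hilbert polynomial `p`. -/
def mP (p : GotzmannPoly) : ℕ := sInf {r | ∃ ρ : ℕ, ∃ u ∈ Fset p ρ, mReg u = r}

/-! ## Lex segments and growth-height-lexicographic Borel sets -/

/-- `a` is smaller than `b` in the deglex order (for monomials of the same degree):
`a k < b k` where `k` is the largest index where they differ. -/
def deglexLT {n : ℕ} (a b : Mon n) : Prop :=
  ∃ k : Fin (n + 1), a k < b k ∧ ∀ l : Fin (n + 1), k < l → a l = b l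

/-- A lex-segment of `T_t`: a set of degree-`t` monomials consisting of the highest terms
with respect to deglex. -/
def IsLexSeg {n : ℕ} (t : ℕ) (L : Set (Mon n)) : Prop :=
  L ⊆ Tset n t ∧ ∀ a ∈ L, ∀ b ∈ Tset n t, deglexLT a b → b ∈ L

/-- A lex-segment in `A ⊆ T_t`: the intersection of a lex-segment of `T_t` with `A`. -/
def LexSegIn {n : ℕ} (t : ℕ) (A S : Set (Mon n)) : Prop :=
  ∃ L : Set (Mon n), IsLexSeg t L ∧ S = L ∩ A

/-- The growth class `B^{(i)} = {m ∈ B : min(m) = i}`. -/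
def growthClass {n : ℕ} (B : Set (Mon n)) (i : Fin (n + 1)) : Set (Mon n) :=
  {m | m ∈ B ∧ 1 ≤ m i ∧ ∀ j : Fin (n + 1), j < i → m j = 0}

/-- The height class `B(i) = {m ∈ B : the exponent of x₀ in m is i}`. -/
def heightClass {n : ℕ} (B : Set (Mon n)) (i : ℕ) : Set (Mon n) :=
  {m | m ∈ B ∧ m 0 = i}

/-- A Borel set `B ⊆ T_t` is growth-lexicographic if all its growth classes are lex-segments
in the corresponding growth classes of `T_t`. -/
def GrowthLex {n : ℕ} (t : ℕ) (B : Set (Mon n)) : Prop :=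
  ∀ i : Fin (n + 1), LexSegIn t (growthClass (Tset n t) i) (growthClass B i)

/-- A Borel set `B ⊆ T_t` is growth-height-lexicographic if `B(0)` is growth-lexicographic
and `B(i)` is a lex-segment in `T_t(i)` for every `0 < i ≤ t`. -/
def GHLex {n : ℕ} (t : ℕ) (B : Set (Mon n)) : Prop :=
  GrowthLex t (heightClass B 0) ∧
  ∀ i : ℕ, 0 < i → i ≤ t → LexSegIn t (heightClass (Tset n t) i) (heightClass B i)

end

/-! ## Growth of `plusPlus` -/

theorem add_one_le_choose (m t : ℕ) : m + 1 ≤ (m + (t + 1)).choose (t + 1) := by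
  induction m with
  | zero => simp
  | succ m ih =>
    have h : m + 1 + (t + 1) = (m + (t + 1)) + 1 := by ring
    rw [h, Nat.choose_succ_succ']
    have : 0 < (m + (t + 1)).choose t := Nat.choose_pos (by omega)
    omega

theorem expTop_eq {a t n : ℕ} (hn : t + 1 ≤ n) (h₁ : n.choose (t + 1) ≤ a)
    (h₂ : a < (n + 1).choose (t + 1)) : expTop a (t + 1) = n := by
  unfold expTop
  rw [Nat.findGreatest_eq_iff]
  refine ⟨?_, fun _ => h₁, fun m hm _ h => ?_⟩
  · obtain ⟨m, rfl⟩ := Nat.exists_eq_add_of_le' hn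
    have := add_one_le_choose m t
    omega
  · have := Nat.choose_le_choose (t + 1) (show n + 1 ≤ m by omega)
    omega

theorem plusPlus_eq {a t n : ℕ} (hn : t + 1 ≤ n) (h₁ : n.choose (t + 1) ≤ a)
    (h₂ : a < (n + 1).choose (t + 1)) :
    plusPlus a (t + 1) = (n + 1).choose (t + 2) + plusPlus (a - n.choose (t + 1)) t := by
  have ha : a ≠ 0 := by
    have := Nat.choose_pos hn
    omega
  rw [plusPlus, if_neg ha, expTop_eq hn h₁ h₂]

@[simp] theorem plusPlus_zero (t : ℕ) : plusPlus 0 t = 0 := by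
  cases t <;> simp [plusPlus]

theorem plusPlus_choose {t n : ℕ} (hn : t + 1 ≤ n) :
    plusPlus (n.choose (t + 1)) (t + 1) = (n + 1).choose (t + 2) := by
  rw [plusPlus_eq hn le_rfl, Nat.sub_self, plusPlus_zero, add_zero]
  rw [Nat.choose_succ_succ']
  have : 0 < n.choose t := Nat.choose_pos (by omega)
  omega

theorem exists_choose_le_lt {a : ℕ} (t : ℕ) (ha : 0 < a) :
    ∃ n, t + 1 ≤ n ∧ n.choose (t + 1) ≤ a ∧ a < (n + 1).choose (t + 1) := by
  have hex : ∃ m : ℕ, a < m.choose (t + 1) :=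
    ⟨a + (t + 1), by have := add_one_le_choose a t; omega⟩
  have hspec := Nat.find_spec hex
  have hlow : t + 2 ≤ Nat.find hex := by
    by_contra! h
    have := Nat.choose_le_choose (t + 1) (show Nat.find hex ≤ t + 1 by omega)
    rw [Nat.choose_self] at this
    omega
  obtain ⟨n, hn⟩ := Nat.exists_eq_add_of_le' (show 1 ≤ Nat.find hex by omega)
  have hmin := Nat.find_min hex (m := n) (by omega)
  rw [hn] at hspec
  exact ⟨n, by omega, by omega, hspec⟩

theorem plusPlus_lt_choose {a t n : ℕ} (hn : t ≤ n) (h : a < n.choose t) :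
    plusPlus a t < (n + 1).choose (t + 1) := by
  induction t generalizing a n with
  | zero => simp [plusPlus]
  | succ t ih =>
    rcases Nat.eq_zero_or_pos a with rfl | ha
    · rw [plusPlus_zero]
      exact Nat.choose_pos (by omega)
    · obtain ⟨m, hm, h₁, h₂⟩ := exists_choose_le_lt t ha
      rw [plusPlus_eq hm h₁ h₂]
      rw [Nat.choose_succ_succ'] at h₂
      have := @ih (a - Nat.choose m (t + 1)) m (by omega) (by omega)
      have hmn : m < n := by
        by_contra! hc
        have := Nat.choose_le_choose (t + 1) hc
        omega
      have h₃ := Nat.choose_le_choose (t + 2) (show m + 2 ≤ n + 1 by omega)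
      rw [Nat.choose_succ_succ' (m + 1) (t + 1)] at h₃
      simp only [add_assoc, Nat.reduceAdd] at *
      omega

theorem plusPlus_lt_plusPlus_succ (a t : ℕ) :
    plusPlus a (t + 1) < plusPlus (a + 1) (t + 1) := by
  induction t generalizing a with
  | zero =>
    have key : ∀ b, plusPlus b 1 = (b + 1).choose 2 := by
      intro b
      rcases Nat.eq_zero_or_pos b with rfl | hb
      · simp
      · simpa using plusPlus_choose (t := 0) (n := b) (by omega)
    rw [zero_add, key, key, Nat.choose_succ_succ' (a + 1) 1, Nat.choose_one_right]
    simp only [Nat.reduceAdd]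
    omega
  | succ t ih =>
    rcases Nat.eq_zero_or_pos a with rfl | ha
    · rw [plusPlus_zero, zero_add]
      have := plusPlus_choose (le_refl (t + 2))
      rw [Nat.choose_self, Nat.choose_self] at this
      omega
    · obtain ⟨n, hn, h₁, h₂⟩ := exists_choose_le_lt (t + 1) ha
      rcases (show a + 1 ≤ (n + 1).choose (t + 1 + 1) from h₂).lt_or_eq with h | h
      · rw [plusPlus_eq hn h₁ h₂, plusPlus_eq hn (Nat.le_succ_of_le h₁) h,
          Nat.succ_eq_add_one, Nat.sub_add_comm h₁]
        exact Nat.add_lt_add_left (ih _) _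
      · rw [h, plusPlus_choose (by omega)]
        exact plusPlus_lt_choose (by omega) h₂

theorem plusPlus_strictMono (t : ℕ) : StrictMono fun a => plusPlus a (t + 1) :=
  strictMono_nat_of_lt_succ fun a => plusPlus_lt_plusPlus_succ a t

theorem plusPlus_mono {a b t : ℕ} (h : a ≤ b) : plusPlus a t ≤ plusPlus b t := by
  cases t with
  | zero => simp [plusPlus]
  | succ t => exact (plusPlus_strictMono t).monotone h

theorem plusPlus_add_le (a c : ℕ) {t : ℕ} (ht : 1 ≤ t) :
    plusPlus a t + c ≤ plusPlus (a + c) t := by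
  obtain ⟨t, rfl⟩ := Nat.exists_eq_add_of_le' ht
  induction c with
  | zero => rfl
  | succ c ih =>
    have := plusPlus_lt_plusPlus_succ (a + c) t
    rw [← add_assoc, ← add_assoc]
    omega

/-! ## The Hilbert function of the lexicographic ideal -/

/-- The Hilbert function of the saturated lexicographic ideal attached to a list
`k₁ ≥ k₂ ≥ ...`: the Gotzmann form truncated to its first `t + 1` terms. -/
def lexHilb : ℕ → List ℕ → ℕ
  | _, [] => 0
  | 0, _ :: _ => 1
  | t + 1, k :: L => (t + 1 + k).choose (t + 1) + lexHilb t L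

@[simp] theorem lexHilb_nil (t : ℕ) : lexHilb t [] = 0 := by cases t <;> rfl

theorem lexHilb_le (t k : ℕ) (L : List ℕ) (hL : ∀ x ∈ L, x ≤ k) :
    lexHilb t L ≤ (t + k + 1).choose t := by
  induction t generalizing L with
  | zero => cases L <;> simp [lexHilb]
  | succ t ih =>
    cases L with
    | nil => simp
    | cons x L =>
      have h₁ := ih L fun y hy => hL y (List.mem_cons_of_mem _ hy)
      have h₂ := Nat.choose_le_choose (t + 1)
        (Nat.add_le_add_left (hL x List.mem_cons_self) (t + 1))
      rw [lexHilb, Nat.choose_succ_succ']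
      rw [show t + 1 + k = t + k + 1 by ring] at *
      omega

theorem lexHilb_pos (t : ℕ) {L : List ℕ} (hL : L ≠ []) : 0 < lexHilb t L := by
  cases L with
  | nil => exact absurd rfl hL
  | cons k L =>
    cases t with
    | zero => simp [lexHilb]
    | succ t =>
      have : 0 < (t + 1 + k).choose (t + 1) := Nat.choose_pos (by omega)
      rw [lexHilb]
      omega

theorem lexHilb_succ_le (t : ℕ) (L : List ℕ) (hL : L.Pairwise (· ≥ ·)) :
    lexHilb (t + 2) L ≤ plusPlus (lexHilb (t + 1) L) (t + 1) := by
  induction t generalizing L with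
  | zero =>
    cases L with
    | nil => simp
    | cons k L =>
      rw [List.pairwise_cons] at hL
      cases L with
      | nil =>
        have := plusPlus_choose (t := 0) (n := 1 + k) (by omega)
        simp only [lexHilb, add_zero, zero_add] at *
        rw [this, show 1 + 1 + k = 1 + k + 1 by ring]
      | cons l L =>
        have h₁ := lexHilb_le 2 k (k :: l :: L) (by simpa using hL.1)
        have h₂ := plusPlus_choose (t := 0) (n := 2 + k) (by omega)
        simp only [zero_add, Nat.choose_one_right] at *
        rw [show lexHilb 1 (k :: l :: L) = 2 + k by simp [lexHilb]; ring, h₂]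
        exact h₁
  | succ t ih =>
    cases L with
    | nil => simp
    | cons k L =>
      rw [List.pairwise_cons] at hL
      have hb := lexHilb_le (t + 1) k L hL.1
      rcases hb.lt_or_eq with h | h
      · have e := plusPlus_eq (a := lexHilb (t + 1 + 1) (k :: L)) (t := t + 1)
          (n := t + 1 + 1 + k) (by omega) (by rw [lexHilb]; omega) (by
            rw [lexHilb, Nat.choose_succ_succ', show t + 1 + 1 + k = t + 1 + k + 1 by ring]
            omega)
        rw [e, lexHilb, lexHilb, Nat.add_sub_cancel_left,
          show t + 1 + 1 + 1 + k = t + 1 + 1 + k + 1 by ring]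
        exact Nat.add_le_add_left (ih L hL.2) _
      · have e : lexHilb (t + 1 + 1) (k :: L) = (t + k + 3).choose (t + 2) := by
          rw [lexHilb, h, Nat.choose_succ_succ' (t + k + 2) (t + 1), add_comm]
          congr 2 <;> ring
        rw [e, plusPlus_choose (by omega)]
        refine (lexHilb_le (t + 3) k (k :: L) (by simpa using hL.1)).trans_eq ?_
        congr 1
        ring

theorem oSeq_lexHilb {L : List ℕ} (hL : L.Pairwise (· ≥ ·)) (hne : L ≠ []) :
    OSeq fun t => (lexHilb t L : ℤ) := by
  refine ⟨fun t => Int.natCast_nonneg _, ?_, fun t ht => ?_⟩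
  · cases L with
    | nil => exact absurd rfl hne
    | cons k L => simp [lexHilb]
  · obtain ⟨t, rfl⟩ := Nat.exists_eq_add_of_le' ht
    simpa using lexHilb_succ_le t L hL

theorem lexHilb_succ_eq (t : ℕ) (L : List ℕ) (hL : ∀ k ∈ L, 1 ≤ k) :
    lexHilb (t + 1) L = lexHilb t L + lexHilb (t + 1) (L.map fun k => k - 1) := by
  induction t generalizing L with
  | zero =>
    cases L with
    | nil => simp
    | cons k L =>
      have := hL k List.mem_cons_self
      cases L with
      | nil => simp [lexHilb]; omega
      | cons l L => simp [lexHilb]; omega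
  | succ t ih =>
    cases L with
    | nil => simp
    | cons k L =>
      obtain ⟨k, rfl⟩ := Nat.exists_eq_add_of_le' (hL k List.mem_cons_self)
      have h := ih L fun y hy => hL y (List.mem_cons_of_mem _ hy)
      simp only [List.map_cons, lexHilb, Nat.add_sub_cancel] at *
      rw [h, show t + 1 + 1 + (k + 1) = (t + k + 2) + 1 by ring,
        Nat.choose_succ_succ', show t + 1 + (k + 1) = t + k + 2 by ring,
        show t + 1 + 1 + k = t + k + 2 by ring]
      omega

theorem nderiv_lexHilb {L : List ℕ} (hL : ∀ k ∈ L, 1 ≤ k) (hne : L ≠ []) :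
    (nderiv fun t => (lexHilb t L : ℤ)) =
      fun t => (lexHilb t (L.map fun k => k - 1) : ℤ) := by
  funext t
  cases t with
  | zero =>
    cases L with
    | nil => exact absurd rfl hne
    | cons k L => simp [nderiv, lexHilb]
  | succ t =>
    have := lexHilb_succ_eq t L hL
    simp only [nderiv]
    omega

/-! ## Evaluation of Gotzmann polynomials -/

theorem zchoose_eq_ringChoose (a : ℤ) (k : ℕ) : zchoose a k = Ring.choose a k := by
  unfold zchoose
  split_ifs with h
  · obtain ⟨n, rfl⟩ := Int.eq_ofNat_of_zero_le h
    simp [Ring.choose_natCast]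
  · obtain ⟨n, hn⟩ := Int.eq_ofNat_of_zero_le (show 0 ≤ (k : ℤ) - 1 - a by omega)
    obtain rfl : a = -((n : ℤ) + 1 - k) := by omega
    rw [hn, Ring.choose_neg, Int.toNat_natCast,
      show (n : ℤ) + 1 - k + k - 1 = n by ring, Ring.choose_natCast, Units.smul_def,
      Int.negOnePow_def, zpow_natCast]
    simp

theorem zchoose_succ_succ (a : ℤ) (k : ℕ) :
    zchoose (a + 1) (k + 1) = zchoose a k + zchoose a (k + 1) := by
  simp only [zchoose_eq_ringChoose, Ring.choose_succ_succ]

@[simp] theorem zchoose_zero_right (a : ℤ) : zchoose a 0 = 1 := by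
  simp [zchoose]

/-- The value at `z` of the Gotzmann form with list of exponents `L`, computed recursively. -/
def evalList : List ℕ → ℤ → ℤ
  | [], _ => 0
  | k :: L, z => zchoose (z + k) k + evalList L (z - 1)

theorem sum_zchoose_eq_evalList (L : List ℕ) (z : ℤ) :
    ∑ i ∈ Finset.range L.length, zchoose (z + (L.getD i 0 : ℤ) - i) (L.getD i 0) =
      evalList L z := by
  induction L generalizing z with
  | nil => simp [evalList]
  | cons k L ih =>
    rw [List.length_cons, Finset.sum_range_succ', evalList, ← ih, add_comm]
    congr 1
    · simp
    · refine Finset.sum_congr rfl fun i _ => ?_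
      simp only [List.getD_cons_succ]
      congr 1
      push_cast
      ring

theorem evalList_eq_lexHilb (L : List ℕ) (t : ℕ) (h : L.length ≤ t + 1) :
    evalList L t = lexHilb t L := by
  induction L generalizing t with
  | nil => simp [evalList]
  | cons k L ih =>
    rw [List.length_cons] at h
    have hk : zchoose ((t : ℤ) + k) k = ((t + k).choose t : ℕ) := by
      rw [zchoose, if_pos (by positivity), ← Nat.cast_add, Int.toNat_natCast,
        Nat.choose_symm_add]
    rw [evalList, hk]
    cases t with
    | zero =>
      obtain rfl : L = [] := List.length_eq_zero_iff.1 (by omega)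
      simp [evalList, lexHilb]
    | succ t =>
      have := ih t (by omega)
      rw [show ((t + 1 : ℕ) : ℤ) - 1 = t by push_cast; ring, this, lexHilb]
      push_cast
      ring

theorem evalList_append_replicate (L : List ℕ) (c : ℕ) (z : ℤ) :
    evalList (L ++ List.replicate c 0) z = evalList L z + c := by
  induction L generalizing z with
  | nil =>
    induction c generalizing z with
    | zero => simp [evalList]
    | succ c ih =>
      simp only [List.nil_append, List.replicate_succ, evalList] at *
      rw [ih]
      simp
      ring
  | cons k L ih =>
    rw [List.cons_append, evalList, evalList, ih]
    ring

theorem exists_eq_append_replicate (L : List ℕ) (hL : L.Pairwise (· ≥ ·)) :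
    ∃ c, L = L.filter (fun k => 1 ≤ k) ++ List.replicate c 0 := by
  induction L with
  | nil => exact ⟨0, by simp⟩
  | cons k L ih =>
    rw [List.pairwise_cons] at hL
    obtain ⟨c, hc⟩ := ih hL.2
    rcases Nat.eq_zero_or_pos k with rfl | hk
    · refine ⟨L.length + 1, ?_⟩
      have h0 : ∀ x ∈ L, x = 0 := fun x hx => Nat.le_zero.1 (hL.1 x hx)
      have hf : L.filter (fun k => 1 ≤ k) = [] := by
        rw [List.filter_eq_nil_iff]
        intro x hx
        simp [h0 x hx]
      rw [List.filter_cons_of_neg (by simp), hf, List.nil_append, List.replicate_succ,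
        ← List.eq_replicate_of_mem h0]
    · refine ⟨c, ?_⟩
      rw [List.filter_cons_of_pos (by simpa using Nat.succ_le_of_lt hk), List.cons_append, ← hc]

theorem evalList_map_pred (L : List ℕ) (hL : ∀ k ∈ L, 1 ≤ k) (z : ℤ) :
    evalList (L.map fun k => k - 1) z = evalList L z - evalList L (z - 1) := by
  induction L generalizing z with
  | nil => simp [evalList]
  | cons k L ih =>
    obtain ⟨k, rfl⟩ := Nat.exists_eq_add_of_le' (hL k List.mem_cons_self)
    have h := zchoose_succ_succ (z + k) k
    rw [List.map_cons, evalList, evalList, evalList,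
      ih fun y hy => hL y (List.mem_cons_of_mem _ hy), Nat.add_sub_cancel]
    push_cast
    rw [show z + ((k : ℤ) + 1) = z + k + 1 by ring, h,
      show z - 1 + ((k : ℤ) + 1) = z + k by ring]
    ring

namespace GotzmannPoly

theorem eval_eq_evalList (p : GotzmannPoly) (z : ℤ) : p.eval z = evalList p.ks z :=
  sum_zchoose_eq_evalList p.ks z

theorem eval_eq_lexHilb (p : GotzmannPoly) {t : ℕ} (h : p.r ≤ t + 1) :
    p.eval t = lexHilb t p.ks := by
  rw [eval_eq_evalList, evalList_eq_lexHilb _ _ h]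

theorem ks_ne_nil {p : GotzmannPoly} (hr : 0 < p.r) : p.ks ≠ [] :=
  List.length_pos_iff.1 hr

theorem eval_addConst (p : GotzmannPoly) (c : ℕ) (z : ℤ) :
    (p.addConst c).eval z = p.eval z + c := by
  rw [eval_eq_evalList, eval_eq_evalList, addConst, evalList_append_replicate]

theorem r_addConst (p : GotzmannPoly) (c : ℕ) : (p.addConst c).r = p.r + c := by
  simp [addConst, r]

theorem eval_delta (p : GotzmannPoly) (z : ℤ) :
    p.delta.eval z = p.eval z - p.eval (z - 1) := by
  obtain ⟨c, hc⟩ := exists_eq_append_replicate p.ks p.sorted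
  rw [eval_eq_evalList, eval_eq_evalList, eval_eq_evalList, hc, evalList_append_replicate,
    evalList_append_replicate, delta, evalList_map_pred _ (by simp)]
  ring

theorem eval_pos (p : GotzmannPoly) (hr : 0 < p.r) {t : ℕ} (h : p.r ≤ t + 1) :
    1 ≤ p.eval t := by
  rw [eval_eq_lexHilb p h]
  exact_mod_cast lexHilb_pos t (ks_ne_nil hr)

end GotzmannPoly

/-! ## The set `PiSet` and lower bounds for the regularity -/

theorem r_mem_PiSet (p : GotzmannPoly) (hr : 0 < p.r) : p.r ∈ PiSet p := by
  refine ⟨hr, le_rfl, fun h => ?_⟩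
  obtain ⟨s, hs⟩ := Nat.exists_eq_add_of_le' hr
  have e₁ : (p.r : ℤ) + h = ((p.r + h : ℕ) : ℤ) := by push_cast; ring
  have e₂ : (p.r : ℤ) + h + 1 = ((p.r + h + 1 : ℕ) : ℤ) := by push_cast; ring
  rw [e₂]
  refine ⟨?_, p.eval_pos hr (by omega)⟩
  rw [e₁, p.eval_eq_lexHilb (by omega), p.eval_eq_lexHilb (by omega), Int.toNat_natCast]
  have := lexHilb_succ_le (s + h) p.ks p.sorted
  rw [show p.r + h = s + h + 1 by omega]
  exact_mod_cast this

theorem rhoP_le_sInf (p : GotzmannPoly) : rhoP p ≤ sInf (PiSet p) := by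
  unfold rhoP
  split_ifs <;> omega

/-- An admissible function agreeing with `p` from `N` on forces `rhoP p ≤ N`. -/
theorem rhoP_le_of_oSeq (p : GotzmannPoly) (hr : 0 < p.r) {H : ℕ → ℤ} {N : ℕ} (hH : OSeq H)
    (hN : ∀ t, N ≤ t → H t = p.eval t) : rhoP p ≤ N := by
  obtain ⟨hnn, h0, hg⟩ := hH
  have hpos : ∀ s, 1 ≤ s → N ≤ s → 1 ≤ H s := by
    intro s hs hNs
    by_contra! hlt
    have hz : ∀ i, H (s + i) = 0 := by
      intro i
      induction i with
      | zero => have := hnn s; simp only [add_zero]; omega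
      | succ i ih =>
        have h₁ := hg (s + i) (by omega)
        rw [ih] at h₁
        have h₂ := hnn (s + i + 1)
        simp only [Int.toNat_zero, plusPlus_zero, Nat.cast_zero] at h₁
        rw [← add_assoc]
        omega
    have h₁ := p.eval_pos hr (t := s + p.r) (by omega)
    rw [← hN _ (by omega), hz] at h₁
    omega
  have hmem : ∀ s, 1 ≤ s → N ≤ s → s ≤ p.r → s ∈ PiSet p := by
    refine fun s hs hNs hsr => ⟨hs, hsr, fun h => ?_⟩
    have e₁ : (s : ℤ) + h = ((s + h : ℕ) : ℤ) := by push_cast; ring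
    have e₂ : (s : ℤ) + h + 1 = ((s + h + 1 : ℕ) : ℤ) := by push_cast; ring
    rw [e₂, e₁, ← hN _ (by omega), ← hN _ (by omega)]
    exact ⟨hg _ (by omega), hpos _ (by omega) (by omega)⟩
  rcases Nat.eq_zero_or_pos N with rfl | hNpos
  · have h₁ : 1 ∈ PiSet p := hmem 1 le_rfl (by omega) hr
    have h₂ : sInf (PiSet p) = 1 :=
      le_antisymm (Nat.sInf_le h₁) (Nat.sInf_mem ⟨1, h₁⟩).1
    have h₃ := hN 0 le_rfl
    rw [h0] at h₃
    rw [rhoP, if_pos ⟨h₂, by exact_mod_cast h₃.symm⟩]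
  · refine (rhoP_le_sInf p).trans ?_
    rcases le_total N p.r with h | h
    · exact Nat.sInf_le (hmem N hNpos le_rfl h)
    · exact (Nat.sInf_le (r_mem_PiSet p hr)).trans h

theorem mem_PiSet_addConst (p : GotzmannPoly) {t : ℕ} (ht : t ∈ PiSet p) (c : ℕ) :
    t ∈ PiSet (p.addConst c) := by
  obtain ⟨h₁, hr, hg⟩ := ht
  refine ⟨h₁, by rw [p.r_addConst]; omega, fun h => ?_⟩
  obtain ⟨hle, hpos⟩ := hg h
  rw [p.eval_addConst, p.eval_addConst]
  refine ⟨?_, by omega⟩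
  have hnn : 0 ≤ p.eval ((t : ℤ) + h) := by
    by_contra! hneg
    rw [Int.toNat_of_nonpos hneg.le, plusPlus_zero] at hle
    push_cast at hle
    omega
  have := plusPlus_add_le (p.eval ((t : ℤ) + h)).toNat c (show 1 ≤ t + h by omega)
  rw [Int.toNat_add hnn (by positivity), Int.toNat_natCast]
  omega

/-! ## Existence of Hilbert functions of schemes and minimal regularity -/

/-- The function `H` with `c` added in all positive degrees. -/
def bump (H : ℕ → ℤ) (c t : ℕ) : ℤ := if t = 0 then H 0 else H t + c

theorem oSeq_bump {H : ℕ → ℤ} (hH : OSeq H) (c : ℕ) : OSeq (bump H c) := by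
  obtain ⟨hnn, h0, hg⟩ := hH
  refine ⟨fun t => ?_, by simp [bump, h0], fun t ht => ?_⟩
  · have := hnn t
    unfold bump
    split_ifs with h
    · exact hnn 0
    · omega
  · have h₁ := hg t ht
    have h₂ := plusPlus_add_le (H t).toNat c ht
    rw [bump, bump, if_neg (by omega), if_neg (by omega),
      Int.toNat_add (hnn t) (by positivity), Int.toNat_natCast]
    omega

theorem oSeq_nderiv_bump {H : ℕ → ℤ} (hH : OSeq (nderiv H)) (c : ℕ) :
    OSeq (nderiv (bump H c)) := by
  obtain ⟨hnn, h0, hg⟩ := hH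
  have h1 : nderiv (bump H c) 1 = nderiv H 1 + c := by
    simp [nderiv, bump]
    ring
  have h2 : ∀ t, nderiv (bump H c) (t + 2) = nderiv H (t + 2) := by
    intro t
    simp [nderiv, bump]
  refine ⟨fun t => ?_, rfl, fun t ht => ?_⟩
  · match t with
    | 0 => simp [nderiv]
    | 1 => have := hnn 1; omega
    | t + 2 => rw [h2]; exact hnn _
  · match t, ht with
    | 1, _ =>
      have := hg 1 le_rfl
      have h₁ : plusPlus (nderiv H 1).toNat 1 ≤ plusPlus (nderiv H 1 + c).toNat 1 :=
        plusPlus_mono (by omega)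
      rw [h1, h2 0]
      simp only [zero_add, Nat.reduceAdd] at *
      omega
    | t + 2, _ =>
      rw [h2 t, h2 (t + 1)]
      exact hg (t + 2) (by omega)

theorem bump_eq_eval_addConst {p : GotzmannPoly} {H : ℕ → ℤ} {N : ℕ} (hN₀ : 0 < N)
    (hN : ∀ t : ℕ, N ≤ t → H t = p.eval t) (c : ℕ) :
    ∀ t : ℕ, N ≤ t → bump H c t = (p.addConst c).eval t := by
  intro t ht
  rw [p.eval_addConst, bump, if_neg (by omega), hN t ht]

theorem exists_mem_Fset_le {p : GotzmannPoly} {H : ℕ → ℤ} {N : ℕ} (h₁ : OSeq H)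
    (h₂ : OSeq (nderiv H)) (hN : ∀ t : ℕ, N ≤ t → H t = p.eval t) :
    ∃ ρ, ρ ≤ N ∧ (Fset p ρ).Nonempty := by
  have hex : ∃ ρ, ∀ t : ℕ, ρ ≤ t → H t = p.eval t := ⟨N, hN⟩
  exact ⟨Nat.find hex, Nat.find_min' hex hN, H, h₁, h₂, Nat.find_spec hex,
    fun ρ' h => Nat.find_min' hex h⟩

theorem exists_oSeq_nderiv (p : GotzmannPoly) (hr : 0 < p.r) :
    ∃ (H : ℕ → ℤ) (N : ℕ), OSeq H ∧ OSeq (nderiv H) ∧ ∀ t : ℕ, N ≤ t → H t = p.eval t := by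
  obtain ⟨c, hc⟩ := exists_eq_append_replicate p.ks p.sorted
  by_cases hne : p.ks.filter (fun k => 1 ≤ k) = []
  · rw [hne, List.nil_append] at hc
    have hrc : p.r = c := by rw [GotzmannPoly.r, hc, List.length_replicate]
    have hev : ∀ z, p.eval z = c := by
      intro z
      have := evalList_append_replicate [] c z
      rw [p.eval_eq_evalList, hc]
      simpa [evalList] using this
    have h1 : OSeq fun _ => 1 := by
      refine ⟨fun _ => zero_le_one, rfl, fun t ht => ?_⟩
      have := plusPlus_add_le 0 1 ht
      simpa using this
    have h2 : OSeq (nderiv fun _ => 1) := by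
      refine ⟨fun t => ?_, rfl, fun t _ => ?_⟩
      · cases t <;> simp [nderiv]
      · simp [nderiv]
    refine ⟨bump (fun _ => 1) (c - 1), 1, oSeq_bump h1 _, oSeq_nderiv_bump h2 _, fun t ht => ?_⟩
    rw [hev, bump, if_neg (by omega)]
    omega
  · let q : GotzmannPoly := ⟨p.ks.filter (fun k => 1 ≤ k), p.sorted.filter _⟩
    have hpos : ∀ k ∈ q.ks, 1 ≤ k := by simp [q]
    have h1 : OSeq fun t => (lexHilb t q.ks : ℤ) := oSeq_lexHilb q.sorted hne
    have h2 : OSeq (nderiv fun t => (lexHilb t q.ks : ℤ)) := by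
      rw [nderiv_lexHilb hpos hne]
      exact oSeq_lexHilb p.delta.sorted (by simpa [q] using hne)
    have hp : p = q.addConst c := by
      cases p
      simpa [q, GotzmannPoly.addConst] using hc
    refine ⟨_, q.r + 1, oSeq_bump h1 c, oSeq_nderiv_bump h2 c, ?_⟩
    rw [hp]
    exact bump_eq_eval_addConst (by omega)
      (fun t ht => (q.eval_eq_lexHilb (by omega)).symm) c

theorem rhobar_le {p : GotzmannPoly} {H : ℕ → ℤ} {N : ℕ} (h₁ : OSeq H)
    (h₂ : OSeq (nderiv H)) (hN : ∀ t : ℕ, N ≤ t → H t = p.eval t) : rhobar p ≤ N := by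
  obtain ⟨ρ, hρ, hF⟩ := exists_mem_Fset_le h₁ h₂ hN
  exact (Nat.sInf_le hF).trans hρ

theorem Fset_rhobar_nonempty (p : GotzmannPoly) (hr : 0 < p.r) :
    (Fset p (rhobar p)).Nonempty := by
  obtain ⟨H, N, h₁, h₂, hN⟩ := exists_oSeq_nderiv p hr
  obtain ⟨ρ, -, hF⟩ := exists_mem_Fset_le h₁ h₂ hN
  exact Nat.sInf_mem (s := {ρ | (Fset p ρ).Nonempty}) ⟨ρ, hF⟩

theorem rhoP_delta_le_of_oSeq_nderiv (p : GotzmannPoly) {H : ℕ → ℤ} {N : ℕ}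
    (hH : OSeq (nderiv H)) (hN : ∀ t : ℕ, N ≤ t → H t = p.eval t) :
    rhoP p.delta ≤ N + 1 := by
  rcases Nat.eq_zero_or_pos p.delta.r with h0 | hpos
  · have he : PiSet p.delta = ∅ := by
      refine Set.eq_empty_of_forall_notMem fun t ht => ?_
      have h₁ := ht.1
      have h₂ := ht.2.1
      omega
    have := rhoP_le_sInf p.delta
    rw [he, Nat.sInf_empty] at this
    omega
  · refine rhoP_le_of_oSeq _ hpos hH fun t ht => ?_
    obtain ⟨t, rfl⟩ := Nat.exists_eq_add_of_le' (show 1 ≤ t by omega)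
    rw [p.eval_delta, nderiv, hN _ (by omega), hN t (by omega)]
    push_cast
    rw [add_sub_cancel_right]

/-- Proposition `prop:varrho`.
The set `Π_p` is non-empty and the minimal regularity of admissible functions with Hilbert
polynomial `p` is lower bounded by `ρ_p`. Moreover (i) `ρ̄_p ≥ max{ρ_p, ρ_{Δp} - 1}`, and
(ii) if `ρ_p > 0` then `ρ_{p+c} ≤ ρ_p` and `ρ̄_{p+c} ≤ ρ̄_p` for every `c > 0`. -/
theorem statement1 (p : GotzmannPoly) (hr : 1 < p.r) :
    (PiSet p).Nonempty ∧
    (∀ (H : ℕ → ℤ) (ρ : ℕ), OSeq H → IsRegOf p H ρ → rhoP p ≤ ρ) ∧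
    (max (rhoP p) (rhoP p.delta - 1) ≤ rhobar p) ∧
    (0 < rhoP p → ∀ c : ℕ, 0 < c →
      rhoP (p.addConst c) ≤ rhoP p ∧ rhobar (p.addConst c) ≤ rhobar p) := by
  have hr0 : 0 < p.r := by omega
  obtain ⟨H, h₁, h₂, hreg⟩ := Fset_rhobar_nonempty p hr0
  have hbar : rhoP p ≤ rhobar p := rhoP_le_of_oSeq p hr0 h₁ hreg.1
  refine ⟨⟨p.r, r_mem_PiSet p hr0⟩, fun H ρ hH h => rhoP_le_of_oSeq p hr0 hH h.1,
    max_le hbar ?_, fun hpos c _ => ⟨?_, ?_⟩⟩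
  · have := rhoP_delta_le_of_oSeq_nderiv p h₂ hreg.1
    omega
  · have hmem : sInf (PiSet p) ∈ PiSet p := Nat.sInf_mem ⟨p.r, r_mem_PiSet p hr0⟩
    have heq : rhoP p = sInf (PiSet p) := by
      unfold rhoP at hpos ⊢
      split_ifs at hpos ⊢
      · omega
      · rfl
    rw [heq]
    exact (rhoP_le_sInf _).trans (Nat.sInf_le (mem_PiSet_addConst p hmem c))
  · exact rhobar_le (oSeq_bump h₁ c) (oSeq_nderiv_bump h₂ c)
      (bump_eq_eval_addConst (by omega) hreg.1 c)
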